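/- Let A be a unital associative algebra over a commutative unital ring R that is 2-torsion free and (n−1)-torsion free, let e be a nontrivial idempotent in A and f = 1 − e, suppose A satisfies property (Q) and moreover eAf·fAe = {0} and fAe·eAf = {0}, let n ≥ 2, and let φ be a Lie n-derivation on A. Then φ = d + δ + γ, where d is a derivation on A, δ is a singular Jordan derivation on A that is also an antiderivation, and γ is an R-linear map from A into Z(A) vanishing on all (n−1)-th commutators of A, if and only if fφ(a)f ∈ fZ(A)f for every a ∈ eAe and eφ(b)e ∈ eZ(A)e for every b ∈ fAf. -/

import Mathlib

open Finset

/-- Iterated commutator: `pCom x k = p_{k+1}(x 0, ..., x k)`, i.e.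
`pCom x 0 = x 0` and `pCom x (k+1) = [pCom x k, x (k+1)]`. -/
def pCom {A : Type*} [Ring A] (x : ℕ → A) : ℕ → A
  | 0 => x 0
  | k + 1 => pCom x k * x (k + 1) - x (k + 1) * pCom x k

/-- `φ` is a Lie `n`-derivation. -/
def IsLieNDeriv {R : Type*} {A : Type*} [CommRing R] [Ring A] [Algebra R A]
    (n : ℕ) (φ : A →ₗ[R] A) : Prop :=
  ∀ x : ℕ → A,
    φ (pCom x (n - 1)) =
      ∑ i ∈ Finset.range n, pCom (Function.update x i (φ (x i))) (n - 1)

/-- `d` is a derivation. -/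
def IsDeriv {R : Type*} {A : Type*} [CommRing R] [Ring A] [Algebra R A]
    (d : A →ₗ[R] A) : Prop :=
  ∀ x y : A, d (x * y) = d x * y + x * d y

/-- `δ` is a Jordan derivation. -/
def IsJordanDeriv {R : Type*} {A : Type*} [CommRing R] [Ring A] [Algebra R A]
    (δ : A →ₗ[R] A) : Prop :=
  ∀ x y : A, δ (x * y + y * x) = δ x * y + y * δ x + x * δ y + δ y * x

/-- `δ` is an antiderivation. -/
def IsAntiDeriv {R : Type*} {A : Type*} [CommRing R] [Ring A] [Algebra R A]
    (δ : A →ₗ[R] A) : Prop :=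
  ∀ x y : A, δ (x * y) = δ y * x + y * δ x

/-- `δ` is a singular Jordan derivation relative to the idempotent `e`
(with `f = 1 - e`): it is a Jordan derivation killing `eAe` and `fAf`,
mapping `eAf` into `fAe` and `fAe` into `eAf`. -/
def IsSingularJordanDeriv {R : Type*} {A : Type*} [CommRing R] [Ring A] [Algebra R A]
    (e : A) (δ : A →ₗ[R] A) : Prop :=
  IsJordanDeriv δ ∧
  (∀ a : A, δ (e * a * e) = 0) ∧
  (∀ b : A, δ ((1 - e) * b * (1 - e)) = 0) ∧
  (∀ m : A, δ (e * m * (1 - e)) = (1 - e) * δ (e * m * (1 - e)) * e) ∧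
  (∀ t : A, δ ((1 - e) * t * e) = e * δ ((1 - e) * t * e) * (1 - e))

/-- `z` is a central element. -/
def IsCent {A : Type*} [Ring A] (z : A) : Prop := ∀ y : A, z * y = y * z

/-- The centre of `A` as a set. -/
def centerSet (A : Type*) [Ring A] : Set A := {z : A | ∀ y : A, z * y = y * z}

/-- `γ` vanishes on all `(n-1)`-th commutators. -/
def VanishesOnNCommutators {R : Type*} {A : Type*} [CommRing R] [Ring A] [Algebra R A]
    (n : ℕ) (γ : A →ₗ[R] A) : Prop :=
  ∀ x : ℕ → A, γ (pCom x (n - 1)) = 0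

/-- A Lie `n`-derivation is standard if it is the sum of a derivation and a
central-valued map vanishing on all `(n-1)`-th commutators. -/
def IsStandardLieNDeriv {R : Type*} {A : Type*} [CommRing R] [Ring A] [Algebra R A]
    (n : ℕ) (φ : A →ₗ[R] A) : Prop :=
  ∃ d γ : A →ₗ[R] A,
    IsDeriv d ∧ (∀ x : A, IsCent (γ x)) ∧ VanishesOnNCommutators n γ ∧ φ = d + γ

/-- Property (Q) for the idempotent `e` (with `f = 1 - e`):
`exe·eAf = 0 = fAe·exe` implies `exe = 0`, and
`eAf·fxf = 0 = fxf·fAe` implies `fxf = 0`. -/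
def PropQ {A : Type*} [Ring A] (e : A) : Prop :=
  (∀ x : A,
    ((∀ y : A, (e * x * e) * (e * y * (1 - e)) = 0) ∧
     (∀ y : A, ((1 - e) * y * e) * (e * x * e) = 0)) → e * x * e = 0) ∧
  (∀ x : A,
    ((∀ y : A, (e * y * (1 - e)) * ((1 - e) * x * (1 - e)) = 0) ∧
     (∀ y : A, ((1 - e) * x * (1 - e)) * ((1 - e) * y * e) = 0)) →
        (1 - e) * x * (1 - e) = 0)

/-- `A` is `k`-torsion free. -/
def TorsionFreeAt (A : Type*) [Ring A] (k : ℕ) : Prop :=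
  ∀ x : A, k • x = 0 → x = 0

/-- The centre of the corner algebra `gAg` (for an idempotent `g`). -/
def cornerCenter {A : Type*} [Ring A] (g : A) : Set A :=
  {z : A | z = g * z * g ∧ ∀ a : A, z * (g * a * g) = (g * a * g) * z}

/-- The corner algebra `gAg` has no nonzero central ideal: every
ideal of `gAg` consisting of elements central in `gAg` is zero. -/
def NoNonzeroCentralIdeal (R : Type*) [CommRing R] (A : Type*) [Ring A] [Algebra R A]
    (g : A) : Prop :=
  ∀ I : Set A, (0 : A) ∈ I →
    (∀ x ∈ I, x = g * x * g) →
    (∀ x ∈ I, ∀ y ∈ I, x + y ∈ I) →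
    (∀ r : R, ∀ x ∈ I, r • x ∈ I) →
    (∀ x ∈ I, ∀ a : A, (g * a * g) * x ∈ I) →
    (∀ x ∈ I, ∀ a : A, x * (g * a * g) ∈ I) →
    (∀ x ∈ I, ∀ a : A, x * (g * a * g) = (g * a * g) * x) →
    ∀ x ∈ I, x = 0

/-- The generating set of `S(gAg)`: all idempotents of `gAg` together with all
commutators of elements of `gAg`. -/
def cornerGenSet {A : Type*} [Ring A] (g : A) : Set A :=
  {x : A | x = g * x * g ∧ x * x = x} ∪
  {x : A | ∃ a b : A, x = (g * a * g) * (g * b * g) - (g * b * g) * (g * a * g)}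

/-- `gAg = S(gAg)`: the corner algebra is generated (as an algebra) by its
idempotents and commutators. -/
def CornerGenerated (R : Type*) [CommRing R] {A : Type*} [Ring A] [Algebra R A]
    (g : A) : Prop :=
  ∀ x : A, g * x * g ∈ NonUnitalAlgebra.adjoin R (cornerGenSet g)

/-- Condition (*) for the corner algebra `gAg`: if `[x, gAg] ⊆ Z(gAg)` then
`x ∈ Z(gAg)`. -/
def CornerCondStar {A : Type*} [Ring A] (g : A) : Prop :=
  ∀ x : A, x = g * x * g →
    (∀ a : A, x * (g * a * g) - (g * a * g) * x ∈ cornerCenter g) →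
    x ∈ cornerCenter g


section IteratedCommutators

variable {A : Type*} [Ring A]

theorem pCom_congr {x y : ℕ → A} {k : ℕ} (h : ∀ i ≤ k, x i = y i) : pCom x k = pCom y k := by
  induction k with
  | zero => exact h 0 le_rfl
  | succ k ih => simp only [pCom, ih fun i hi => h i (by omega), h (k + 1) le_rfl]

theorem pCom_eq_zero_of_isCent {x : ℕ → A} {i k : ℕ} (hk : 1 ≤ k) (hi : i ≤ k)
    (hx : IsCent (x i)) : pCom x k = 0 := by
  induction k with
  | zero => omega
  | succ k ih =>
    rcases hi.lt_or_eq with h | h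
    · rcases Nat.eq_zero_or_pos k with rfl | hk
      · obtain rfl : i = 0 := by omega
        simp only [pCom, hx (x (0 + 1)), sub_self]
      · simp only [pCom, ih hk (by omega), zero_mul, mul_zero, sub_self]
    · subst h
      simp only [pCom, hx (pCom x k), sub_self]

theorem pCom_mem_of_mem (J : Set A) (hJ : ∀ w ∈ J, ∀ y, w * y - y * w ∈ J ∧ y * w - w * y ∈ J)
    {x : ℕ → A} {i k : ℕ} (hi : i ≤ k) (hx : x i ∈ J) : pCom x k ∈ J := by
  induction k with
  | zero =>
    obtain rfl : i = 0 := by omega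
    exact hx
  | succ k ih =>
    rcases hi.lt_or_eq with h | h
    · exact (hJ _ (ih (by omega)) _).1
    · subst h
      exact (hJ _ hx _).2

variable {R : Type*} [CommRing R] [Algebra R A]

/-- The map `x ↦ [x, e]`. -/
def commRight (R : Type*) {A : Type*} [CommRing R] [Ring A] [Algebra R A] (e : A) :
    A →ₗ[R] A :=
  LinearMap.mulRight R e - LinearMap.mulLeft R e

theorem commRight_apply (e x : A) : commRight R e x = x * e - e * x := by
  simp [commRight]

theorem isDeriv_commRight (u : A) : IsDeriv (commRight R u) := by
  intro x y
  simp only [commRight_apply]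
  noncomm_ring

theorem pCom_add_of_eq (R : Type*) [CommRing R] [Algebra R A] {x : ℕ → A} {e : A} {j : ℕ}
    (h : ∀ i, j < i → x i = e) (k : ℕ) :
    pCom x (j + k) = (commRight R e ^ k) (pCom x j) := by
  induction k with
  | zero => simp
  | succ k ih =>
    rw [pow_succ', Module.End.mul_apply, ← ih, commRight_apply, ← add_assoc, pCom,
      h (j + k + 1) (by omega)]

theorem IsDeriv.map_pCom {d : A →ₗ[R] A} (hd : IsDeriv d) (x : ℕ → A) (k : ℕ) :
    d (pCom x k) = ∑ i ∈ Finset.range (k + 1), pCom (Function.update x i (d (x i))) k := by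
  induction k with
  | zero => simp [pCom]
  | succ k ih =>
    rw [Finset.sum_range_succ]
    have h1 : ∀ i ∈ Finset.range (k + 1), pCom (Function.update x i (d (x i))) (k + 1) =
        pCom (Function.update x i (d (x i))) k * x (k + 1) -
          x (k + 1) * pCom (Function.update x i (d (x i))) k := by
      intro i hi
      have hi := Finset.mem_range.1 hi
      rw [pCom, Function.update_of_ne (by omega)]
    have h2 : pCom (Function.update x (k + 1) (d (x (k + 1)))) k = pCom x k :=
      pCom_congr fun i hi => Function.update_of_ne (by omega) _ _
    rw [Finset.sum_congr rfl h1, Finset.sum_sub_distrib, ← Finset.sum_mul, ← Finset.mul_sum, ← ih,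
      pCom, pCom, h2, Function.update_self, map_sub, hd, hd]
    abel

theorem IsDeriv.isLieNDeriv {d : A →ₗ[R] A} (hd : IsDeriv d) {n : ℕ} (hn : 1 ≤ n) :
    IsLieNDeriv n d := by
  intro x
  rw [hd.map_pCom, Nat.sub_add_cancel hn]

theorem pCom_update_add {x y z : ℕ → A} {i : ℕ} (hxy : ∀ j, j ≠ i → x j = z j ∧ y j = z j)
    (hi : z i = x i + y i) {k : ℕ} (hk : i ≤ k) : pCom z k = pCom x k + pCom y k := by
  induction k with
  | zero =>
    obtain rfl : i = 0 := by omega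
    exact hi
  | succ k ih =>
    rcases hk.lt_or_eq with h | h
    · have := hxy (k + 1) (by omega)
      simp only [pCom, ih (by omega), this.1, this.2]
      noncomm_ring
    · subst h
      have h1 : pCom x k = pCom z k := pCom_congr fun j hj => (hxy j (by omega)).1
      have h2 : pCom y k = pCom z k := pCom_congr fun j hj => (hxy j (by omega)).2
      simp only [pCom, h1, h2, hi]
      noncomm_ring

theorem pCom_update_map_add (x : ℕ → A) (a b : A) {i k : ℕ} (hk : i ≤ k) :
    pCom (Function.update x i (a + b)) k =
      pCom (Function.update x i a) k + pCom (Function.update x i b) k := by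
  refine pCom_update_add (i := i) (fun j hj => ?_) (by simp) hk
  simp [Function.update_of_ne hj]

theorem sum_pCom_update_add (φ ψ : A →ₗ[R] A) (x : ℕ → A) {n : ℕ} :
    ∑ i ∈ Finset.range n, pCom (Function.update x i ((φ + ψ) (x i))) (n - 1) =
      ∑ i ∈ Finset.range n, pCom (Function.update x i (φ (x i))) (n - 1) +
        ∑ i ∈ Finset.range n, pCom (Function.update x i (ψ (x i))) (n - 1) := by
  rw [← Finset.sum_add_distrib]
  refine Finset.sum_congr rfl fun i hi => ?_
  have hi := Finset.mem_range.1 hi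
  rw [LinearMap.add_apply, pCom_update_map_add _ _ _ (by omega)]

theorem IsLieNDeriv.sub {n : ℕ} {φ ψ : A →ₗ[R] A} (hφ : IsLieNDeriv n φ)
    (hψ : IsLieNDeriv n ψ) : IsLieNDeriv n (φ - ψ) := by
  intro x
  have h := sum_pCom_update_add (φ - ψ) ψ x (n := n)
  rw [sub_add_cancel, ← hφ x, ← hψ x] at h
  rw [LinearMap.sub_apply, h, add_sub_cancel_right]

/-- The effect of a Lie derivation on `[w, e, …, e]`. -/
theorem IsLieNDeriv.map_commRight_pow {k : ℕ} {φ : A →ₗ[R] A} (hφ : IsLieNDeriv (k + 2) φ)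
    {e : A} (he : φ e * e = e * φ e) (w : A) :
    φ ((commRight R e ^ (k + 1)) w) = (commRight R e ^ (k + 1)) (φ w) +
      (k + 1) • (commRight R e ^ k) (w * φ e - φ e * w) := by
  have hcomm : ∀ (j : ℕ) (v : A),
      commRight R (φ e) ((commRight R e ^ j) v) = (commRight R e ^ j) (commRight R (φ e) v) := by
    have h0 : Commute (commRight R (φ e)) (commRight R e) := by
      ext v
      simp only [Module.End.mul_apply, commRight_apply, mul_sub, sub_mul, mul_assoc, he]
      simp only [← mul_assoc, he]
      abel
    intro j v
    rw [← Module.End.mul_apply, (h0.pow_right j).eq, Module.End.mul_apply]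
  have hx := hφ (Function.update (fun _ => e) 0 w)
  have hconst : ∀ (v : A) (j : ℕ),
      pCom (Function.update (fun _ => e) 0 v) j = (commRight R e ^ j) v := by
    intro v j
    have := pCom_add_of_eq R (x := Function.update (fun _ => e) 0 v) (e := e) (j := 0)
      (fun i hi => Function.update_of_ne (by omega) _ _) j
    simpa [pCom] using this
  have hterm : ∀ i ∈ Finset.range (k + 1),
      pCom (Function.update (Function.update (fun _ => e) 0 w) (i + 1)
        (φ (Function.update (fun _ => e) 0 w (i + 1)))) (k + 1) =
      (commRight R e ^ k) (w * φ e - φ e * w) := by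
    intro i hi
    have hi := Finset.mem_range.1 hi
    obtain ⟨j, rfl⟩ : ∃ j, k = i + j := ⟨k - i, by omega⟩
    rw [Function.update_of_ne (a := i + 1) (a' := 0) (by omega), show i + j + 1 = i + 1 + j by omega,
      pCom_add_of_eq R (e := e) (fun l hl => by
        rw [Function.update_of_ne (by omega), Function.update_of_ne (by omega)])]
    rw [pCom, Function.update_self, pCom_congr (y := Function.update (fun _ => e) 0 w)
      (fun l hl => Function.update_of_ne (by omega) _ _), hconst, ← commRight_apply (R := R), hcomm,
      ← Module.End.mul_apply, ← pow_add, commRight_apply, add_comm j i]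
  rw [show k + 2 - 1 = k + 1 by omega, Finset.sum_range_succ', Finset.sum_congr rfl hterm,
    Finset.sum_const, Finset.card_range, hconst, Function.update_self, Function.update_idem,
    hconst] at hx
  rw [hx, add_comm]

/-- The effect of a Lie derivation sending `e` to the centre on `[y, z, e, …, e]`. -/
theorem IsLieNDeriv.map_commRight_pow_comm {k : ℕ} {φ : A →ₗ[R] A}
    (hφ : IsLieNDeriv (k + 2) φ) {e : A} (he : IsCent (φ e)) (y z : A) :
    φ ((commRight R e ^ k) (y * z - z * y)) =
      (commRight R e ^ k) (φ y * z - z * φ y + (y * φ z - φ z * y)) := by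
  set s : A → A → ℕ → A := fun y z => Function.update (Function.update (fun _ => e) 1 z) 0 y
    with hs
  have hconst : ∀ y z : A, pCom (s y z) (k + 1) = (commRight R e ^ k) (y * z - z * y) := by
    intro y z
    rw [add_comm k 1, pCom_add_of_eq R (x := s y z) (e := e) (j := 1) (fun i hi => by
      simp only [hs]
      rw [Function.update_of_ne (by omega), Function.update_of_ne (by omega)])]
    simp [pCom, hs]
  have hx := hφ (s y z)
  have hterm : ∀ i ∈ Finset.range k,
      pCom (Function.update (s y z) (i + 1 + 1) (φ (s y z (i + 1 + 1)))) (k + 1) = 0 := by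
    intro i hi
    have hi := Finset.mem_range.1 hi
    refine pCom_eq_zero_of_isCent (i := i + 1 + 1) (by omega) (by omega) ?_
    rw [Function.update_self]
    simp only [hs]
    rwa [Function.update_of_ne (by omega), Function.update_of_ne (by omega)]
  have h0 : Function.update (s y z) 0 (φ (s y z 0)) = s (φ y) z := by
    simp [hs]
  have h1 : Function.update (s y z) (0 + 1) (φ (s y z (0 + 1))) = s y (φ z) := by
    simp only [hs]
    rw [Function.update_comm (by omega), Function.update_idem, Function.update_of_ne (by omega),
      Function.update_self]
  rw [show k + 2 - 1 = k + 1 by omega, Finset.sum_range_succ', Finset.sum_range_succ',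
    Finset.sum_eq_zero hterm, h0, h1, hconst, hconst, hconst, zero_add, ← map_add, add_comm] at hx
  exact hx

end IteratedCommutators

section Peirce

variable {A : Type*} [Ring A]

/-- `x` lies in the Peirce corner `pAq`, for idempotents `p` and `q`. -/
def InCorner (p q x : A) : Prop := p * x = x ∧ x * q = x

theorem InCorner.mul {p q r x y : A} (hx : InCorner p q x) (hy : InCorner q r y) :
    InCorner p r (x * y) :=
  ⟨by rw [← mul_assoc, hx.1], by rw [mul_assoc, hy.2]⟩

theorem InCorner.mul_eq_zero {p q r s x y : A} (hx : InCorner p q x) (hy : InCorner r s y)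
    (hqr : q * r = 0) : x * y = 0 := by
  rw [← hx.2, ← hy.1, mul_assoc, ← mul_assoc q, hqr, zero_mul, mul_zero]

theorem InCorner.add {p q x y : A} (hx : InCorner p q x) (hy : InCorner p q y) :
    InCorner p q (x + y) :=
  ⟨by rw [mul_add, hx.1, hy.1], by rw [add_mul, hx.2, hy.2]⟩

theorem InCorner.sub {p q x y : A} (hx : InCorner p q x) (hy : InCorner p q y) :
    InCorner p q (x - y) :=
  ⟨by rw [mul_sub, hx.1, hy.1], by rw [sub_mul, hx.2, hy.2]⟩

theorem InCorner.eq {p q x : A} (hx : InCorner p q x) : p * x * q = x := by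
  rw [hx.1, hx.2]

theorem InCorner.mul_central_mul {e f z m : A} (hm : InCorner e f m) (hz : IsCent z) :
    e * z * e * m = m * (f * z * f) := by
  rw [mul_assoc, hm.1, mul_assoc, hz m, ← mul_assoc, hm.1, ← mul_assoc, ← mul_assoc, hm.2,
    mul_assoc, hz f, ← mul_assoc, hm.2]

theorem inCorner_mul_mul {p q : A} (hp : p * p = p) (hq : q * q = q) (x : A) :
    InCorner p q (p * x * q) :=
  ⟨by rw [← mul_assoc, ← mul_assoc, hp], by rw [mul_assoc, hq]⟩

/-- `e` and `f` are complementary idempotents. -/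
structure ComplIdem (e f : A) : Prop where
  ee : e * e = e
  ff : f * f = f
  ef : e * f = 0
  fe : f * e = 0
  add : e + f = 1

theorem complIdem_one_sub {e : A} (he : e * e = e) : ComplIdem e (1 - e) where
  ee := he
  ff := by simp [sub_mul, mul_sub, he]
  ef := by simp [mul_sub, he]
  fe := by simp [sub_mul, he]
  add := by abel

namespace ComplIdem

variable {e f : A}

theorem symm (h : ComplIdem e f) : ComplIdem f e :=
  ⟨h.ff, h.ee, h.fe, h.ef, by rw [add_comm, h.add]⟩

theorem ee_mul (h : ComplIdem e f) (x : A) : e * (e * x) = e * x := by rw [← mul_assoc, h.ee]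

theorem ff_mul (h : ComplIdem e f) (x : A) : f * (f * x) = f * x := h.symm.ee_mul x

theorem ef_mul (h : ComplIdem e f) (x : A) : e * (f * x) = 0 := by
  rw [← mul_assoc, h.ef, zero_mul]

theorem fe_mul (h : ComplIdem e f) (x : A) : f * (e * x) = 0 := h.symm.ef_mul x

theorem decomp (h : ComplIdem e f) (x : A) :
    x = e * x * e + e * x * f + (f * x * e + f * x * f) := by
  rw [← mul_add, ← mul_add, h.add, mul_one, mul_one, ← add_mul, h.add, one_mul]

theorem induction (h : ComplIdem e f) {P : A → Prop} (add : ∀ x y, P x → P y → P (x + y))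
    (hee : ∀ x, InCorner e e x → P x) (hef : ∀ x, InCorner e f x → P x)
    (hfe : ∀ x, InCorner f e x → P x) (hff : ∀ x, InCorner f f x → P x) (x : A) : P x := by
  rw [h.decomp x]
  exact add _ _
    (add _ _ (hee _ (inCorner_mul_mul h.ee h.ee x)) (hef _ (inCorner_mul_mul h.ee h.ff x)))
    (add _ _ (hfe _ (inCorner_mul_mul h.ff h.ee x)) (hff _ (inCorner_mul_mul h.ff h.ff x)))

section CommRight

variable {R : Type*} [CommRing R] [Algebra R A]

theorem mul_commRight_mul_ef (h : ComplIdem e f) (w : A) :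
    e * commRight R e w * f = -(e * w * f) := by
  simp only [commRight_apply, mul_sub, sub_mul, mul_assoc, h.ef, h.ee_mul, mul_zero, zero_sub]

theorem mul_commRight_mul_fe (h : ComplIdem e f) (w : A) :
    f * commRight R e w * e = f * w * e := by
  simp only [commRight_apply, mul_sub, mul_assoc, h.ee, h.fe_mul, sub_zero]

theorem mul_commRight_pow_mul_ef (h : ComplIdem e f) (k : ℕ) (w : A) :
    e * (commRight R e ^ k) w * f = (-1 : ℤ) ^ k • (e * w * f) := by
  induction k with
  | zero => simp
  | succ k ih =>
    rw [pow_succ', Module.End.mul_apply, h.mul_commRight_mul_ef, ih, pow_succ']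
    simp

theorem mul_commRight_pow_mul_fe (h : ComplIdem e f) (k : ℕ) (w : A) :
    f * (commRight R e ^ k) w * e = f * w * e := by
  induction k with
  | zero => simp
  | succ k ih => rw [pow_succ', Module.End.mul_apply, h.mul_commRight_mul_fe, ih]

theorem mul_commRight_pow_succ_mul_ee (h : ComplIdem e f) (k : ℕ) (w : A) :
    e * (commRight R e ^ (k + 1)) w * e = 0 := by
  simp only [pow_succ', Module.End.mul_apply, commRight_apply, mul_sub, sub_mul, mul_assoc, h.ee,
    h.ee_mul, sub_self]

theorem mul_commRight_pow_succ_mul_ff (h : ComplIdem e f) (k : ℕ) (w : A) :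
    f * (commRight R e ^ (k + 1)) w * f = 0 := by
  simp only [pow_succ', Module.End.mul_apply, commRight_apply, mul_sub, mul_assoc, h.ef,
    h.fe_mul, mul_zero, sub_zero]

theorem commRight_pow_of_ef (h : ComplIdem e f) (k : ℕ) {m : A} (hm : InCorner e f m) :
    (commRight R e ^ k) m = (-1 : ℤ) ^ k • m := by
  induction k with
  | zero => simp
  | succ k ih =>
    have h0 : m * e = 0 := by rw [← hm.2, mul_assoc, h.fe, mul_zero]
    rw [pow_succ', Module.End.mul_apply, ih, map_zsmul, commRight_apply, h0, hm.1, pow_succ']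
    simp

theorem commRight_pow_of_fe (h : ComplIdem e f) (k : ℕ) {t : A} (ht : InCorner f e t) :
    (commRight R e ^ k) t = t := by
  induction k with
  | zero => simp
  | succ k ih =>
    have h0 : e * t = 0 := by rw [← ht.1, h.ef_mul]
    rw [pow_succ', Module.End.mul_apply, ih, commRight_apply, h0, ht.2, sub_zero]

theorem commRight_compl (h : ComplIdem e f) : commRight R f = -commRight R e := by
  ext w
  obtain rfl : f = 1 - e := eq_sub_of_add_eq' h.add
  simp only [commRight_apply, LinearMap.neg_apply]
  noncomm_ring

end CommRight

end ComplIdem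

/-- Complementary idempotents `e`, `f` satisfying property (Q), with `eAf · fAe = 0` and
`fAe · eAf = 0`. -/
structure TrivialPeirce (e f : A) : Prop extends ComplIdem e f where
  eq_zero_ee : ∀ a, InCorner e e a → (∀ m, InCorner e f m → a * m = 0) →
    (∀ t, InCorner f e t → t * a = 0) → a = 0
  eq_zero_ff : ∀ b, InCorner f f b → (∀ t, InCorner f e t → b * t = 0) →
    (∀ m, InCorner e f m → m * b = 0) → b = 0
  ef_mul_fe : ∀ m t, InCorner e f m → InCorner f e t → m * t = 0
  fe_mul_ef : ∀ t m, InCorner f e t → InCorner e f m → t * m = 0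

theorem PropQ.trivialPeirce {e : A} (hQ : PropQ e) (he : e * e = e)
    (hprod : ∀ m t : A, (e * m * (1 - e)) * ((1 - e) * t * e) = 0 ∧
        ((1 - e) * t * e) * (e * m * (1 - e)) = 0) : TrivialPeirce e (1 - e) where
  toComplIdem := complIdem_one_sub he
  eq_zero_ee a ha hm ht := by
    have hc := complIdem_one_sub he
    rw [← ha.eq]
    refine hQ.1 a ⟨fun y => ?_, fun y => ?_⟩ <;> rw [ha.eq]
    · exact hm _ (inCorner_mul_mul hc.ee hc.ff y)
    · exact ht _ (inCorner_mul_mul hc.ff hc.ee y)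
  eq_zero_ff b hb ht hm := by
    have hc := complIdem_one_sub he
    rw [← hb.eq]
    refine hQ.2 b ⟨fun y => ?_, fun y => ?_⟩ <;> rw [hb.eq]
    · exact hm _ (inCorner_mul_mul hc.ee hc.ff y)
    · exact ht _ (inCorner_mul_mul hc.ff hc.ee y)
  ef_mul_fe m t hm ht := by
    rw [← hm.eq, ← ht.eq]
    exact (hprod m t).1
  fe_mul_ef t m ht hm := by
    rw [← hm.eq, ← ht.eq]
    exact (hprod m t).2

namespace TrivialPeirce

variable {e f : A}

theorem symm (h : TrivialPeirce e f) : TrivialPeirce f e :=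
  ⟨h.toComplIdem.symm, h.eq_zero_ff, h.eq_zero_ee, h.fe_mul_ef, h.ef_mul_fe⟩

theorem commute_of_intertwine (h : TrivialPeirce e f) {a b : A} (ha : InCorner e e a)
    (hm : ∀ m, InCorner e f m → a * m = m * b) (ht : ∀ t, InCorner f e t → t * a = b * t)
    {c : A} (hc : InCorner e e c) : a * c = c * a := by
  refine sub_eq_zero.1 (h.eq_zero_ee _ ((ha.mul hc).sub (hc.mul ha)) (fun m hm' => ?_)
    fun t ht' => ?_)
  · rw [sub_mul, mul_assoc, mul_assoc, hm _ (hc.mul hm'), hm _ hm', mul_assoc, sub_self]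
  · rw [mul_sub, ← mul_assoc, ← mul_assoc, ht _ (ht'.mul hc), ht _ ht', mul_assoc, sub_self]

theorem isCent_add (h : TrivialPeirce e f) {a b : A} (ha : InCorner e e a) (hb : InCorner f f b)
    (hm : ∀ m, InCorner e f m → a * m = m * b) (ht : ∀ t, InCorner f e t → t * a = b * t) :
    IsCent (a + b) := by
  refine h.induction (fun x y hx hy => ?_) (fun c hc => ?_) (fun m hm' => ?_) (fun t ht' => ?_)
    fun c hc => ?_
  · rw [mul_add, hx, hy, add_mul x y]
  · rw [add_mul, mul_add, h.commute_of_intertwine ha hm ht hc, hb.mul_eq_zero hc h.fe,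
      hc.mul_eq_zero hb h.ef]
  · rw [add_mul, mul_add, hm _ hm', hb.mul_eq_zero hm' h.fe, hm'.mul_eq_zero ha h.fe, add_comm]
  · rw [add_mul, mul_add, ht _ ht', ha.mul_eq_zero ht' h.ef, ht'.mul_eq_zero hb h.ef, add_comm]
  · rw [add_mul, mul_add, ha.mul_eq_zero hc h.ef, hc.mul_eq_zero ha h.fe,
      h.symm.commute_of_intertwine hb (fun t ht' => (ht t ht').symm)
        (fun m hm' => (hm m hm').symm) hc]

theorem central_eq_zero (h : TrivialPeirce e f) {z : A} (hz : IsCent z) (hf : f * z * f = 0) :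
    z = 0 := by
  have h1 : e * z * f = 0 := by rw [mul_assoc, hz, h.ef_mul]
  have h2 : f * z * e = 0 := by rw [mul_assoc, hz, h.fe_mul]
  have h3 : e * z * e = 0 := by
    refine h.eq_zero_ee _ (inCorner_mul_mul h.ee h.ee z) (fun m hm => ?_) fun t ht => ?_
    · rw [hm.mul_central_mul hz, hf, mul_zero]
    · rw [← ht.mul_central_mul hz, hf, zero_mul]
  rw [h.decomp z, h1, h2, h3, hf]
  simp

variable {R : Type*} [CommRing R] [Algebra R A]

theorem exists_central_lift (h : TrivialPeirce e f) (ψ : A →ₗ[R] A)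
    (hψ : ∀ x, ∃ z, IsCent z ∧ f * ψ x * f = f * z * f) :
    ∃ ζ : A →ₗ[R] A, (∀ x, IsCent (ζ x)) ∧ ∀ x, f * ψ x * f = f * ζ x * f := by
  choose ζ hζ hψζ using hψ
  refine ⟨⟨⟨ζ, fun x y => ?_⟩, fun r x => ?_⟩, hζ, hψζ⟩
  · refine sub_eq_zero.1 (h.central_eq_zero (fun w => ?_) ?_)
    · simp only [sub_mul, mul_sub, add_mul, mul_add, hζ _ w]
    · simp only [sub_mul, mul_sub, add_mul, mul_add, ← hψζ, map_add]
      abel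
  · refine sub_eq_zero.1 (h.central_eq_zero (fun w => ?_) ?_)
    · simp only [RingHom.id_apply, sub_mul, mul_sub, smul_mul_assoc, mul_smul_comm, hζ _ w]
    · simp only [RingHom.id_apply, sub_mul, mul_sub, smul_mul_assoc, mul_smul_comm, ← hψζ,
        map_smul, sub_self]

theorem map_mul_ee (h : TrivialPeirce e f) {d : A →ₗ[R] A}
    (hee : ∀ a, InCorner e e a → InCorner e e (d a))
    (hem : ∀ a m, InCorner e e a → InCorner e f m → d (a * m) = d a * m + a * d m)
    (hte : ∀ t a, InCorner f e t → InCorner e e a → d (t * a) = d t * a + t * d a)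
    {a c : A} (ha : InCorner e e a) (hc : InCorner e e c) : d (a * c) = d a * c + a * d c := by
  refine sub_eq_zero.1 (h.eq_zero_ee _ ?_ (fun m hm => ?_) fun t ht => ?_)
  · exact (hee _ (ha.mul hc)).sub (((hee _ ha).mul hc).add (ha.mul (hee _ hc)))
  · have h1 := hem _ _ (ha.mul hc) hm
    rw [mul_assoc, hem _ _ ha (hc.mul hm), hem _ _ hc hm] at h1
    rw [sub_mul, sub_eq_zero, ← add_left_inj (a * c * d m), ← h1]
    noncomm_ring
  · have h1 := hte _ _ ht (ha.mul hc)
    rw [← mul_assoc, hte _ _ (ht.mul ha) hc, hte _ _ ht ha] at h1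
    rw [mul_sub, sub_eq_zero, ← add_right_inj (d t * (a * c)), ← h1]
    noncomm_ring

theorem isDeriv (h : TrivialPeirce e f) {d : A →ₗ[R] A}
    (hee : ∀ a, InCorner e e a → InCorner e e (d a))
    (hff : ∀ b, InCorner f f b → InCorner f f (d b))
    (hef : ∀ m, InCorner e f m → InCorner e f (d m))
    (hfe : ∀ t, InCorner f e t → InCorner f e (d t))
    (hem : ∀ a m, InCorner e e a → InCorner e f m → d (a * m) = d a * m + a * d m)
    (hmf : ∀ m b, InCorner e f m → InCorner f f b → d (m * b) = d m * b + m * d b)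
    (hte : ∀ t a, InCorner f e t → InCorner e e a → d (t * a) = d t * a + t * d a)
    (hft : ∀ b t, InCorner f f b → InCorner f e t → d (b * t) = d b * t + b * d t) :
    IsDeriv d := by
  have key : ∀ {x y : A}, x * y = 0 → d x * y = 0 → x * d y = 0 →
      d (x * y) = d x * y + x * d y := by
    intro x y h1 h2 h3
    rw [h1, h2, h3, map_zero, add_zero]
  have key₂ : ∀ {p q r s x y : A}, InCorner p q x → InCorner p q (d x) → InCorner r s y →
      InCorner r s (d y) → q * r = 0 → d (x * y) = d x * y + x * d y :=
    fun hx hdx hy hdy hqr =>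
      key (hx.mul_eq_zero hy hqr) (hdx.mul_eq_zero hy hqr) (hx.mul_eq_zero hdy hqr)
  have hadd : ∀ x y z, d (x * y) = d x * y + x * d y → d (x * z) = d x * z + x * d z →
      d (x * (y + z)) = d x * (y + z) + x * d (y + z) := by
    intro x y z hy hz
    rw [mul_add, map_add, map_add, hy, hz]
    noncomm_ring
  intro x y
  refine h.induction (P := fun x => d (x * y) = d x * y + x * d y) (fun x z hx hz => ?_)
    (fun x hx => ?_) (fun x hx => ?_) (fun x hx => ?_) (fun x hx => ?_) x
  · rw [add_mul, map_add, map_add, hx, hz]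
    noncomm_ring
  · exact h.induction (hadd x) (fun y hy => h.map_mul_ee hee hem hte hx hy)
      (fun y hy => hem _ _ hx hy) (fun y hy => key₂ hx (hee _ hx) hy (hfe _ hy) h.ef)
      (fun y hy => key₂ hx (hee _ hx) hy (hff _ hy) h.ef) y
  · exact h.induction (hadd x) (fun y hy => key₂ hx (hef _ hx) hy (hee _ hy) h.fe)
      (fun y hy => key₂ hx (hef _ hx) hy (hef _ hy) h.fe)
      (fun y hy => key (h.ef_mul_fe _ _ hx hy) (h.ef_mul_fe _ _ (hef _ hx) hy)
        (h.ef_mul_fe _ _ hx (hfe _ hy))) (fun y hy => hmf _ _ hx hy) y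
  · exact h.induction (hadd x) (fun y hy => hte _ _ hx hy)
      (fun y hy => key (h.fe_mul_ef _ _ hx hy) (h.fe_mul_ef _ _ (hfe _ hx) hy)
        (h.fe_mul_ef _ _ hx (hef _ hy))) (fun y hy => key₂ hx (hfe _ hx) hy (hfe _ hy) h.ef)
      (fun y hy => key₂ hx (hfe _ hx) hy (hff _ hy) h.ef) y
  · exact h.induction (hadd x) (fun y hy => key₂ hx (hff _ hx) hy (hee _ hy) h.fe)
      (fun y hy => key₂ hx (hff _ hx) hy (hef _ hy) h.fe) (fun y hy => hft _ _ hx hy)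
      (fun y hy => h.symm.map_mul_ee hff hft hmf hx hy) y

theorem isAntiDeriv (h : TrivialPeirce e f) {δ : A →ₗ[R] A}
    (hee : ∀ a, InCorner e e a → δ a = 0) (hff : ∀ b, InCorner f f b → δ b = 0)
    (hef : ∀ m, InCorner e f m → InCorner f e (δ m))
    (hfe : ∀ t, InCorner f e t → InCorner e f (δ t))
    (hem : ∀ a m, InCorner e e a → InCorner e f m → δ (a * m) = δ m * a)
    (hmf : ∀ m b, InCorner e f m → InCorner f f b → δ (m * b) = b * δ m)
    (hte : ∀ t a, InCorner f e t → InCorner e e a → δ (t * a) = a * δ t)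
    (hft : ∀ b t, InCorner f f b → InCorner f e t → δ (b * t) = δ t * b) :
    IsAntiDeriv δ := by
  have hadd : ∀ x y z, δ (x * y) = δ y * x + y * δ x → δ (x * z) = δ z * x + z * δ x →
      δ (x * (y + z)) = δ (y + z) * x + (y + z) * δ x := by
    intro x y z hy hz
    rw [mul_add, map_add, map_add, hy, hz]
    noncomm_ring
  intro x y
  refine h.induction (P := fun x => δ (x * y) = δ y * x + y * δ x) (fun x z hx hz => ?_)
    (fun x hx => ?_) (fun x hx => ?_) (fun x hx => ?_) (fun x hx => ?_) x
  · rw [add_mul, map_add, map_add, hx, hz]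
    noncomm_ring
  · refine h.induction (hadd x) (fun y hy => ?_) (fun y hy => ?_) (fun y hy => ?_)
      (fun y hy => ?_) y
    · simp [hee _ (hx.mul hy), hee _ hx, hee _ hy]
    · simp [hem _ _ hx hy, hee _ hx]
    · simp [hx.mul_eq_zero hy h.ef, (hfe _ hy).mul_eq_zero hx h.fe, hee _ hx]
    · simp [hx.mul_eq_zero hy h.ef, hee _ hx, hff _ hy]
  · refine h.induction (hadd x) (fun y hy => ?_) (fun y hy => ?_) (fun y hy => ?_)
      (fun y hy => ?_) y
    · simp [hx.mul_eq_zero hy h.fe, hee _ hy, hy.mul_eq_zero (hef _ hx) h.ef]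
    · simp [hx.mul_eq_zero hy h.fe, h.fe_mul_ef _ _ (hef _ hy) hx, h.ef_mul_fe _ _ hy (hef _ hx)]
    · simp [h.ef_mul_fe _ _ hx hy, (hfe _ hy).mul_eq_zero hx h.fe,
        hy.mul_eq_zero (hef _ hx) h.ef]
    · simp [hmf _ _ hx hy, hff _ hy]
  · refine h.induction (hadd x) (fun y hy => ?_) (fun y hy => ?_) (fun y hy => ?_)
      (fun y hy => ?_) y
    · simp [hte _ _ hx hy, hee _ hy]
    · simp [h.fe_mul_ef _ _ hx hy, (hef _ hy).mul_eq_zero hx h.ef,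
        hy.mul_eq_zero (hfe _ hx) h.fe]
    · simp [hx.mul_eq_zero hy h.ef, h.ef_mul_fe _ _ (hfe _ hy) hx, h.fe_mul_ef _ _ hy (hfe _ hx)]
    · simp [hx.mul_eq_zero hy h.ef, hff _ hy, hy.mul_eq_zero (hfe _ hx) h.fe]
  · refine h.induction (hadd x) (fun y hy => ?_) (fun y hy => ?_) (fun y hy => ?_)
      (fun y hy => ?_) y
    · simp [hx.mul_eq_zero hy h.fe, hff _ hx, hee _ hy]
    · simp [hx.mul_eq_zero hy h.fe, (hef _ hy).mul_eq_zero hx h.ef, hff _ hx]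
    · simp [hft _ _ hx hy, hff _ hx]
    · simp [hff _ (hx.mul hy), hff _ hx, hff _ hy]

end TrivialPeirce

end Peirce

section AdCompatible

variable {R A : Type*} [CommRing R] [Ring A] [Algebra R A] {e f : A} {k : ℕ} {φ : A →ₗ[R] A}

/-- `φ` acts as a Lie `(k + 2)`-derivation on `[y, z, e, …, e]` when `φ e` does not contribute. -/
structure AdCompatible (k : ℕ) (e : A) (φ : A →ₗ[R] A) : Prop where
  map_pow : ∀ w, φ ((commRight R e ^ (k + 1)) w) = (commRight R e ^ (k + 1)) (φ w)
  map_pow_comm : ∀ y z, φ ((commRight R e ^ k) (y * z - z * y)) =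
    (commRight R e ^ k) (φ y * z - z * φ y + (y * φ z - φ z * y))

theorem IsLieNDeriv.adCompatible (hφ : IsLieNDeriv (k + 2) φ) (he : IsCent (φ e)) :
    AdCompatible k e φ where
  map_pow w := by
    rw [hφ.map_commRight_pow (he e), he w, sub_self, map_zero, smul_zero, add_zero]
  map_pow_comm := hφ.map_commRight_pow_comm he

theorem IsLieNDeriv.isCent_apply (hφ : IsLieNDeriv (k + 2) φ) (h : TrivialPeirce e f)
    (htf : TorsionFreeAt A (k + 1)) (hef : e * φ e * f = 0) (hfe : f * φ e * e = 0) :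
    IsCent (φ e) := by
  have hdec : φ e = e * φ e * e + f * φ e * f := by
    conv_lhs => rw [h.decomp (φ e), hef, hfe, add_zero, zero_add]
  have hee := inCorner_mul_mul h.ee h.ee (φ e)
  have hff := inCorner_mul_mul h.ff h.ff (φ e)
  have hcomm : φ e * e = e * φ e := by
    rw [hdec]
    simp only [mul_add, add_mul, mul_assoc, h.ee, h.fe, h.ee_mul, h.ef_mul, mul_zero]
  rw [hdec]
  refine h.isCent_add hee hff (fun m hm => ?_) fun t ht => ?_
  · have h1 := hφ.map_commRight_pow hcomm m
    rw [h.commRight_pow_of_ef _ hm, map_zsmul] at h1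
    have h2 := congrArg (fun x => e * x * f) h1
    have h3 : m * φ e - φ e * m = m * (f * φ e * f) - e * φ e * e * m := by
      conv_lhs => rw [hdec]
      rw [mul_add, add_mul, hm.mul_eq_zero hee h.fe, hff.mul_eq_zero hm h.fe, zero_add, add_zero]
    have h4 : InCorner e f (m * (f * φ e * f) - e * φ e * e * m) :=
      (hm.mul hff).sub (hee.mul hm)
    simp only [mul_add, add_mul, mul_smul_comm, smul_mul_assoc, h.mul_commRight_pow_mul_ef] at h2
    rw [h3, h4.eq, left_eq_add, smul_comm] at h2
    rcases neg_one_pow_eq_or ℤ k with hk | hk <;> rw [hk] at h2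
    · rw [one_smul] at h2
      exact (sub_eq_zero.1 (htf _ h2)).symm
    · rw [neg_one_smul, neg_eq_zero] at h2
      exact (sub_eq_zero.1 (htf _ h2)).symm
  · have h1 := hφ.map_commRight_pow hcomm t
    rw [h.commRight_pow_of_fe _ ht] at h1
    have h2 := congrArg (fun x => f * x * e) h1
    have h3 : t * φ e - φ e * t = t * (e * φ e * e) - f * φ e * f * t := by
      conv_lhs => rw [hdec]
      rw [mul_add, add_mul, ht.mul_eq_zero hff h.ef, hee.mul_eq_zero ht h.ef, zero_add, add_zero]
    have h4 : InCorner f e (t * (e * φ e * e) - f * φ e * f * t) :=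
      (ht.mul hee).sub (hff.mul ht)
    simp only [mul_add, add_mul, mul_smul_comm, smul_mul_assoc, h.mul_commRight_pow_mul_fe] at h2
    rw [h3, h4.eq, left_eq_add] at h2
    exact sub_eq_zero.1 (htf _ h2)

theorem eq_zero_of_neg_one_pow_zsmul {k : ℕ} {x : A} (hx : (-1 : ℤ) ^ k • x = 0) : x = 0 := by
  rcases neg_one_pow_eq_or ℤ k with hk | hk <;> rw [hk] at hx <;> simpa using hx

theorem neg_one_pow_zsmul_injective {k : ℕ} {x y : A}
    (hxy : (-1 : ℤ) ^ k • x = (-1 : ℤ) ^ k • y) : x = y := by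
  rw [← sub_eq_zero, ← smul_sub] at hxy
  exact sub_eq_zero.1 (eq_zero_of_neg_one_pow_zsmul hxy)

namespace AdCompatible

theorem compl (hφ : AdCompatible k e φ) (h : ComplIdem e f) : AdCompatible k f φ := by
  have hpow : ∀ (j : ℕ) (w : A),
      (commRight R f ^ j) w = (-1 : ℤ) ^ j • (commRight R e ^ j) w := by
    intro j w
    induction j with
    | zero => simp
    | succ j ih =>
      rw [pow_succ', Module.End.mul_apply, ih, h.commRight_compl, map_zsmul, LinearMap.neg_apply,
        pow_succ' (commRight R e), Module.End.mul_apply, pow_succ]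
      simp
  refine ⟨fun w => ?_, fun y z => ?_⟩
  · rw [hpow, hpow, map_zsmul, hφ.map_pow]
  · rw [hpow, hpow, map_zsmul, hφ.map_pow_comm]

theorem map_ef_diag (hφ : AdCompatible k e φ) (h : ComplIdem e f) {m : A}
    (hm : InCorner e f m) : e * φ m * e = 0 ∧ f * φ m * f = 0 := by
  have h1 := hφ.map_pow m
  rw [h.commRight_pow_of_ef _ hm, map_zsmul] at h1
  constructor
  · have h2 := congrArg (fun x => e * x * e) h1
    simp only [mul_smul_comm, smul_mul_assoc, h.mul_commRight_pow_succ_mul_ee] at h2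
    exact eq_zero_of_neg_one_pow_zsmul h2
  · have h2 := congrArg (fun x => f * x * f) h1
    simp only [mul_smul_comm, smul_mul_assoc, h.mul_commRight_pow_succ_mul_ff] at h2
    exact eq_zero_of_neg_one_pow_zsmul h2

theorem map_ef_eq (hφ : AdCompatible k e φ) (h : ComplIdem e f) {m : A}
    (hm : InCorner e f m) : φ m = e * φ m * f + f * φ m * e := by
  have h1 := hφ.map_ef_diag h hm
  conv_lhs => rw [h.decomp (φ m), h1.1, h1.2, zero_add, add_zero]

theorem map_ef_swap (hφ : AdCompatible k e φ) (h : ComplIdem e f) {m : A}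
    (hm : InCorner e f m) : (-1 : ℤ) ^ k • (f * φ m * e) = -(f * φ m * e) := by
  have h1 := hφ.map_pow m
  rw [h.commRight_pow_of_ef _ hm, map_zsmul] at h1
  have h2 := congrArg (fun x => f * x * e) h1
  simp only [mul_smul_comm, smul_mul_assoc, h.mul_commRight_pow_mul_fe] at h2
  rw [pow_succ, mul_neg_one, neg_smul] at h2
  rw [← neg_eq_iff_eq_neg, h2]

theorem map_ee_eq (hφ : AdCompatible k e φ) (h : ComplIdem e f) {a : A}
    (ha : InCorner e e a) : φ a = e * φ a * e + f * φ a * f := by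
  have h1 := hφ.map_pow a
  have h0 : (commRight R e ^ (k + 1)) a = 0 := by
    rw [pow_succ, Module.End.mul_apply, commRight_apply, ha.1, ha.2, sub_self, map_zero]
  rw [h0, map_zero] at h1
  have h2 := congrArg (fun x => e * x * f) h1
  have h3 := congrArg (fun x => f * x * e) h1
  simp only [h.mul_commRight_pow_mul_ef, h.mul_commRight_pow_mul_fe, mul_zero, zero_mul] at h2 h3
  have h4 := eq_zero_of_neg_one_pow_zsmul h2.symm
  conv_lhs => rw [h.decomp (φ a), h4, ← h3, zero_add, add_zero]

theorem map_ee_mul_ef (hφ : AdCompatible k e φ) (h : ComplIdem e f) {a m : A}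
    (ha : InCorner e e a) (hm : InCorner e f m) :
    e * φ (a * m) * f = e * φ a * e * m - m * (f * φ a * f) + a * (e * φ m * f) ∧
      f * φ (a * m) * e = f * φ m * e * a := by
  have h1 := hφ.map_pow_comm a m
  rw [hm.mul_eq_zero ha h.fe, sub_zero, h.commRight_pow_of_ef _ (ha.mul hm), map_zsmul] at h1
  constructor
  · have h2 := congrArg (fun x => e * x * f) h1
    simp only [mul_smul_comm, smul_mul_assoc, h.mul_commRight_pow_mul_ef] at h2
    rw [neg_one_pow_zsmul_injective h2]
    generalize φ a = u
    generalize φ m = v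
    rw [← ha.eq, ← hm.eq]
    simp only [mul_add, add_mul, mul_sub, sub_mul, mul_assoc, h.ff, h.ef, h.ee_mul, h.ff_mul,
      mul_zero, sub_zero]
  · have h2 := congrArg (fun x => f * x * e) h1
    simp only [mul_smul_comm, smul_mul_assoc, h.mul_commRight_pow_mul_fe] at h2
    rw [hφ.map_ef_swap h (ha.mul hm), neg_eq_iff_eq_neg] at h2
    rw [h2]
    generalize φ a = u
    generalize φ m = v
    rw [← ha.eq, ← hm.eq]
    simp only [mul_add, add_mul, mul_sub, mul_assoc, h.ee, h.fe, h.ee_mul, h.fe_mul,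
      mul_zero, sub_zero, zero_sub, zero_add, neg_mul, neg_neg]

theorem map_fe_mul_ee (hφ : AdCompatible k e φ) (h : ComplIdem e f) {t a : A}
    (ht : InCorner f e t) (ha : InCorner e e a) :
    f * φ (t * a) * e = f * φ t * e * a + (t * (e * φ a * e) - f * φ a * f * t) ∧
      e * φ (t * a) * f = a * (e * φ t * f) := by
  have h1 := hφ.map_pow_comm t a
  rw [ha.mul_eq_zero ht h.ef, sub_zero, h.commRight_pow_of_fe _ (ht.mul ha)] at h1
  constructor
  · have h2 := congrArg (fun x => f * x * e) h1
    simp only [h.mul_commRight_pow_mul_fe] at h2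
    rw [h2]
    generalize φ a = u
    generalize φ t = v
    rw [← ha.eq, ← ht.eq]
    simp only [mul_add, add_mul, mul_sub, sub_mul, mul_assoc, h.ee, h.ee_mul, h.ff_mul, h.fe_mul,
      sub_zero]
  · have h2 := congrArg (fun x => e * x * f) h1
    have h3 := (hφ.compl h).map_ef_swap h.symm (ht.mul ha)
    simp only [h.mul_commRight_pow_mul_ef] at h2
    have h4 : e * (φ t * a - a * φ t + (t * φ a - φ a * t)) * f = -(e * φ (t * a) * f) := by
      rw [← h3, h2, smul_smul, ← mul_pow, neg_one_mul, neg_neg, one_pow, one_smul]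
    rw [← neg_eq_iff_eq_neg.2 h4]
    generalize φ a = u
    generalize φ t = v
    rw [← ha.eq, ← ht.eq]
    simp only [mul_add, add_mul, mul_sub, sub_mul, mul_assoc, h.ef, h.ee_mul, h.ef_mul,
      mul_zero, neg_mul, zero_sub, neg_zero, add_zero, neg_neg]

/-- Subtracting a suitable central map turns `φ` into a derivation on the Peirce corners. -/
theorem sub_central (hφ : AdCompatible k e φ) (h : ComplIdem e f) {a z : A}
    (ha : InCorner e e a) (hz : IsCent z) (hza : f * φ a * f = f * z * f) :
    InCorner e e (φ a - z) ∧
      (∀ m, InCorner e f m → e * φ (a * m) * f = (φ a - z) * m + a * (e * φ m * f)) ∧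
      ∀ t, InCorner f e t → f * φ (t * a) * e = f * φ t * e * a + t * (φ a - z) := by
  have hzdec : z = e * z * e + f * z * f := by
    conv_lhs => rw [h.decomp z, mul_assoc e z f, hz f, mul_assoc f z e, hz e, h.ef_mul, h.fe_mul,
      add_zero, zero_add]
  have hee := inCorner_mul_mul h.ee h.ee (φ a)
  have hzee := inCorner_mul_mul h.ee h.ee z
  have hd : φ a - z = e * φ a * e - e * z * e := by
    have h1 := hφ.map_ee_eq h ha
    rw [hza] at h1
    calc
      φ a - z = e * φ a * e + f * z * f - (e * z * e + f * z * f) := by rw [← h1, ← hzdec]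
      _ = e * φ a * e - e * z * e := add_sub_add_right_eq_sub _ _ _
  rw [hd]
  refine ⟨hee.sub hzee, fun m hm => ?_, fun t ht => ?_⟩
  · rw [(hφ.map_ee_mul_ef h ha hm).1, hza, sub_mul, hm.mul_central_mul hz]
  · rw [(hφ.map_fe_mul_ee h ht ha).1, hza, mul_sub, ht.mul_central_mul hz]

theorem exists_decomposition (hφ : AdCompatible k e φ) (h : TrivialPeirce e f)
    (he : ∀ x, ∃ z, IsCent z ∧ f * φ (e * x * e) * f = f * z * f)
    (hf : ∀ x, ∃ z, IsCent z ∧ e * φ (f * x * f) * e = e * z * e) :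
    ∃ d δ γ : A →ₗ[R] A, IsDeriv d ∧ IsAntiDeriv δ ∧
      (∀ a, InCorner e e a → δ a = 0) ∧ (∀ b, InCorner f f b → δ b = 0) ∧
      (∀ m, InCorner e f m → InCorner f e (δ m)) ∧
      (∀ t, InCorner f e t → InCorner e f (δ t)) ∧
      (∀ x, IsCent (γ x)) ∧ φ = d + δ + γ := by
  obtain ⟨ζ, hζ, hφζ⟩ := h.exists_central_lift (φ ∘ₗ LinearMap.mulLeftRight R (e, e))
    (by simpa using he)
  obtain ⟨η, hη, hφη⟩ := h.symm.exists_central_lift (φ ∘ₗ LinearMap.mulLeftRight R (f, f))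
    (by simpa using hf)
  simp only [LinearMap.comp_apply, LinearMap.mulLeftRight_apply] at hφζ hφη
  replace hφζ : ∀ a, InCorner e e a → f * φ a * f = f * ζ a * f := fun a ha => by
    rw [← hφζ, ha.eq]
  replace hφη : ∀ b, InCorner f f b → e * φ b * e = e * η b * e := fun b hb => by
    rw [← hφη, hb.eq]
  have hφ' := hφ.compl h.toComplIdem
  have hc := h.toComplIdem
  obtain ⟨δ, hδ⟩ : ∃ δ : A →ₗ[R] A, ∀ x, δ x = f * φ (e * x * f) * e + e * φ (f * x * e) * f :=
    ⟨LinearMap.mulLeftRight R (f, e) ∘ₗ φ ∘ₗ LinearMap.mulLeftRight R (e, f) +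
      LinearMap.mulLeftRight R (e, f) ∘ₗ φ ∘ₗ LinearMap.mulLeftRight R (f, e), fun x => by simp⟩
  obtain ⟨γ, hγ⟩ : ∃ γ : A →ₗ[R] A, ∀ x, γ x = ζ (e * x * e) + η (f * x * f) :=
    ⟨ζ ∘ₗ LinearMap.mulLeftRight R (e, e) + η ∘ₗ LinearMap.mulLeftRight R (f, f),
      fun x => by simp⟩
  have hδee : ∀ a, InCorner e e a → δ a = 0 := fun a ha => by
    rw [hδ, ← ha.eq]
    simp [mul_assoc, hc.ef, hc.fe_mul]
  have hδff : ∀ b, InCorner f f b → δ b = 0 := fun b hb => by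
    rw [hδ, ← hb.eq]
    simp [mul_assoc, hc.fe, hc.ef_mul]
  have hδef : ∀ m, InCorner e f m → δ m = f * φ m * e := fun m hm => by
    have h0 : f * m * e = 0 := by rw [← hm.1, hc.fe_mul, zero_mul]
    rw [hδ, hm.eq, h0]
    simp
  have hδfe : ∀ t, InCorner f e t → δ t = e * φ t * f := fun t ht => by
    have h0 : e * t * f = 0 := by rw [← ht.1, hc.ef_mul, zero_mul]
    rw [hδ, ht.eq, h0]
    simp
  have hγee : ∀ a, InCorner e e a → γ a = ζ a := fun a ha => by
    have h0 : f * a * f = 0 := by rw [← ha.1, hc.fe_mul, zero_mul]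
    rw [hγ, ha.eq, h0, map_zero, add_zero]
  have hγff : ∀ b, InCorner f f b → γ b = η b := fun b hb => by
    have h0 : e * b * e = 0 := by rw [← hb.1, hc.ef_mul, zero_mul]
    rw [hγ, hb.eq, h0, map_zero, zero_add]
  have hγef : ∀ m, InCorner e f m → γ m = 0 := fun m hm => by
    rw [hγ, ← hm.eq]
    simp [mul_assoc, hc.fe, hc.fe_mul]
  have hγfe : ∀ t, InCorner f e t → γ t = 0 := fun t ht => by
    rw [hγ, ← ht.eq]
    simp [mul_assoc, hc.ef, hc.ef_mul]
  obtain ⟨d, hd⟩ : ∃ d : A →ₗ[R] A, d = φ - δ - γ := ⟨_, rfl⟩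
  have hdee : ∀ a, InCorner e e a → d a = φ a - ζ a := fun a ha => by
    simp [hd, hδee a ha, hγee a ha]
  have hdff : ∀ b, InCorner f f b → d b = φ b - η b := fun b hb => by
    simp [hd, hδff b hb, hγff b hb]
  have hdef : ∀ m, InCorner e f m → d m = e * φ m * f := fun m hm => by
    simp only [hd, LinearMap.sub_apply, hδef m hm, hγef m hm, sub_zero]
    nth_rewrite 1 [hφ.map_ef_eq hc hm]
    abel
  have hdfe : ∀ t, InCorner f e t → d t = f * φ t * e := fun t ht => by
    simp only [hd, LinearMap.sub_apply, hδfe t ht, hγfe t ht, sub_zero]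
    nth_rewrite 1 [hφ'.map_ef_eq hc.symm ht]
    abel
  have hsub := fun a (ha : InCorner e e a) => hφ.sub_central hc ha (hζ a) (hφζ a ha)
  have hsub' := fun b (hb : InCorner f f b) => hφ'.sub_central hc.symm hb (hη b) (hφη b hb)
  refine ⟨d, δ, γ, ?_, ?_, hδee, hδff, fun m hm => ?_, fun t ht => ?_, fun x w => ?_, ?_⟩
  · refine h.isDeriv (fun a ha => ?_) (fun b hb => ?_) (fun m hm => ?_) (fun t ht => ?_)
      (fun a m ha hm => ?_) (fun m b hm hb => ?_) (fun t a ht ha => ?_) (fun b t hb ht => ?_)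
    · rw [hdee a ha]
      exact (hsub a ha).1
    · rw [hdff b hb]
      exact (hsub' b hb).1
    · rw [hdef m hm]
      exact inCorner_mul_mul hc.ee hc.ff _
    · rw [hdfe t ht]
      exact inCorner_mul_mul hc.ff hc.ee _
    · rw [hdef _ (ha.mul hm), hdef m hm, hdee a ha]
      exact (hsub a ha).2.1 m hm
    · rw [hdef _ (hm.mul hb), hdef m hm, hdff b hb]
      exact (hsub' b hb).2.2 m hm
    · rw [hdfe _ (ht.mul ha), hdfe t ht, hdee a ha]
      exact (hsub a ha).2.2 t ht
    · rw [hdfe _ (hb.mul ht), hdfe t ht, hdff b hb]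
      exact (hsub' b hb).2.1 t ht
  · refine h.isAntiDeriv hδee hδff (fun m hm => ?_) (fun t ht => ?_)
      (fun a m ha hm => ?_) (fun m b hm hb => ?_) (fun t a ht ha => ?_) (fun b t hb ht => ?_)
    · rw [hδef m hm]
      exact inCorner_mul_mul hc.ff hc.ee _
    · rw [hδfe t ht]
      exact inCorner_mul_mul hc.ee hc.ff _
    · rw [hδef _ (ha.mul hm), hδef m hm, (hφ.map_ee_mul_ef hc ha hm).2]
    · rw [hδef _ (hm.mul hb), hδef m hm, (hφ'.map_fe_mul_ee hc.symm hm hb).2]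
    · rw [hδfe _ (ht.mul ha), hδfe t ht, (hφ.map_fe_mul_ee hc ht ha).2]
    · rw [hδfe _ (hb.mul ht), hδfe t ht, (hφ'.map_ee_mul_ef hc.symm hb ht).2]
  · rw [hδef m hm]
    exact inCorner_mul_mul hc.ff hc.ee _
  · rw [hδfe t ht]
    exact inCorner_mul_mul hc.ee hc.ff _
  · rw [hγ, add_mul, mul_add, hζ, hη]
  · rw [hd]
    abel

end AdCompatible

end AdCompatible

section Decomposition

variable {R A : Type*} [CommRing R] [Ring A] [Algebra R A] {e f : A}

theorem IsAntiDeriv.isJordanDeriv {δ : A →ₗ[R] A} (hδ : IsAntiDeriv δ) : IsJordanDeriv δ := by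
  intro x y
  rw [map_add, hδ, hδ]
  abel

theorem IsDeriv.mul_map_mul_eq_zero {d : A →ₗ[R] A} (hd : IsDeriv d) (h : ComplIdem e f)
    {a : A} (ha : InCorner e e a) : f * d a * f = 0 := by
  have h1 : d a = d e * a + e * d a := by rw [← hd, ha.1]
  have h0 : a * f = 0 := by rw [← ha.2, mul_assoc, h.ef, mul_zero]
  rw [h1, mul_add, add_mul, h.fe_mul, mul_assoc, mul_assoc, h0]
  simp

/-- The off-diagonal elements `eAf + fAe`. -/
def offDiagonal (R : Type*) {A : Type*} [CommRing R] [Ring A] [Algebra R A] (e f : A) :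
    Submodule R A :=
  LinearMap.ker (LinearMap.mulLeftRight R (e, e)) ⊓ LinearMap.ker (LinearMap.mulLeftRight R (f, f))

theorem mem_offDiagonal {x : A} : x ∈ offDiagonal R e f ↔ e * x * e = 0 ∧ f * x * f = 0 := by
  simp [offDiagonal]

theorem TrivialPeirce.mul_mem_offDiagonal (h : TrivialPeirce e f) {x : A}
    (hx : x ∈ offDiagonal R e f) (y : A) :
    x * y ∈ offDiagonal R e f ∧ y * x ∈ offDiagonal R e f := by
  rw [mem_offDiagonal] at hx
  have hc : ∀ p : A, p * (x * y) * p = p * x * e * (e * y * p) + p * x * f * (f * y * p) ∧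
      p * (y * x) * p = p * y * e * (e * x * p) + p * y * f * (f * x * p) := by
    intro p
    have h1 : ∀ u v : A, u * v = u * (e * v) + u * (f * v) := fun u v => by
      rw [← mul_add, ← add_mul, h.add, one_mul]
    constructor <;> simp only [mul_assoc, h.ee_mul, h.ff_mul, ← mul_add] <;>
      rw [← add_mul, h.add, one_mul]
  have hef := fun z => inCorner_mul_mul h.ee h.ff z
  have hfe := fun z => inCorner_mul_mul h.ff h.ee z
  simp only [mem_offDiagonal, hc, hx.1, hx.2, h.ef_mul_fe _ _ (hef _) (hfe _),
    h.fe_mul_ef _ _ (hfe _) (hef _), zero_mul, mul_zero, add_zero, and_self]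

theorem vanishesOnNCommutators_of_add (h : TrivialPeirce e f) {n : ℕ} (hn : 2 ≤ n)
    {d δ γ : A →ₗ[R] A} (hφ : IsLieNDeriv n (d + δ + γ)) (hd : IsDeriv d)
    (hδ : ∀ x, δ x ∈ offDiagonal R e f) (hγ : ∀ x, IsCent (γ x)) :
    VanishesOnNCommutators n γ := by
  intro x
  have h1 := hφ x
  have hγ0 : ∑ i ∈ Finset.range n, pCom (Function.update x i (γ (x i))) (n - 1) = 0 := by
    refine Finset.sum_eq_zero fun i hi => ?_
    have hi := Finset.mem_range.1 hi
    refine pCom_eq_zero_of_isCent (i := i) (by omega) (by omega) ?_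
    rw [Function.update_self]
    exact hγ _
  have hδ0 : ∑ i ∈ Finset.range n, pCom (Function.update x i (δ (x i))) (n - 1) ∈
      offDiagonal R e f := by
    refine sum_mem fun i hi => ?_
    have hi := Finset.mem_range.1 hi
    refine pCom_mem_of_mem (i := i) (offDiagonal R e f : Set A) (fun w hw y => ?_) (by omega) ?_
    · have := h.mul_mem_offDiagonal hw y
      exact ⟨sub_mem this.1 this.2, sub_mem this.2 this.1⟩
    · rw [Function.update_self]
      exact hδ _
  rw [sum_pCom_update_add, sum_pCom_update_add, hγ0, ← hd.isLieNDeriv (by omega) x] at h1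
  have h2 : γ (pCom x (n - 1)) ∈ offDiagonal R e f := by
    have h3 : γ (pCom x (n - 1)) =
        ∑ i ∈ Finset.range n, pCom (Function.update x i (δ (x i))) (n - 1) -
          δ (pCom x (n - 1)) := by
      rw [LinearMap.add_apply, LinearMap.add_apply, add_zero, add_assoc, add_right_inj] at h1
      rw [← h1, add_sub_cancel_left]
    rw [h3]
    exact sub_mem hδ0 (hδ _)
  exact h.central_eq_zero (hγ _) (mem_offDiagonal.1 h2).2

end Decomposition

theorem stmt_6 (R : Type*) [CommRing R] (A : Type*) [Ring A] [Algebra R A]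
    (n : ℕ) (hn : 2 ≤ n)
    (h2 : TorsionFreeAt A 2) (hn1 : TorsionFreeAt A (n - 1))
    (e : A) (he : e * e = e) (he0 : e ≠ 0) (he1 : e ≠ 1) (hQ : PropQ e)
    (hprod : ∀ m t : A, (e * m * (1 - e)) * ((1 - e) * t * e) = 0 ∧
        ((1 - e) * t * e) * (e * m * (1 - e)) = 0)
    (φ : A →ₗ[R] A) (hφ : IsLieNDeriv n φ) :
    (∃ d δ γ : A →ₗ[R] A,
        IsDeriv d ∧ IsSingularJordanDeriv e δ ∧ IsAntiDeriv δ ∧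
        (∀ x : A, IsCent (γ x)) ∧ VanishesOnNCommutators n γ ∧
        φ = d + δ + γ) ↔
      ((∀ a : A, ∃ z : A, IsCent z ∧
          (1 - e) * φ (e * a * e) * (1 - e) = (1 - e) * z * (1 - e)) ∧
       (∀ b : A, ∃ z : A, IsCent z ∧
          e * φ ((1 - e) * b * (1 - e)) * e = e * z * e)) := by
  have h : TrivialPeirce e (1 - e) := hQ.trivialPeirce he hprod
  have hc := h.toComplIdem
  have hee := fun x => inCorner_mul_mul hc.ee hc.ee x
  have hff := fun x => inCorner_mul_mul hc.ff hc.ff x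
  have hef := fun x => inCorner_mul_mul hc.ee hc.ff x
  have hfe := fun x => inCorner_mul_mul hc.ff hc.ee x
  constructor
  · rintro ⟨d, δ, γ, hd, ⟨-, hδe, hδf, -⟩, -, hγ, -, rfl⟩
    refine ⟨fun a => ⟨_, hγ (e * a * e), ?_⟩, fun b => ⟨_, hγ ((1 - e) * b * (1 - e)), ?_⟩⟩
    · rw [LinearMap.add_apply, LinearMap.add_apply, hδe, add_zero, mul_add _ (d _), add_mul,
        hd.mul_map_mul_eq_zero hc (hee a), zero_add]
    · rw [LinearMap.add_apply, LinearMap.add_apply, hδf, add_zero, mul_add _ (d _), add_mul,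
        hd.mul_map_mul_eq_zero hc.symm (hff b), zero_add]
  · rintro ⟨hφe, hφf⟩
    obtain ⟨k, rfl⟩ : ∃ k, n = k + 2 := ⟨n - 2, by omega⟩
    generalize hf : 1 - e = f at *
    set D := commRight R (e * φ e * f - f * φ e * e) with hD
    have hDd : IsDeriv D := isDeriv_commRight _
    have hφD : IsLieNDeriv (k + 2) (φ - D) := hφ.sub (hDd.isLieNDeriv (by omega))
    have hDe : D e = f * φ e * e + e * φ e * f := by
      simp only [hD, commRight_apply, sub_mul, mul_sub, mul_assoc, hc.ee, hc.fe, hc.ee_mul,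
        hc.ef_mul, mul_zero, sub_zero, zero_sub, sub_neg_eq_add]
      exact add_comm _ _
    have hcent : IsCent ((φ - D) e) := by
      refine hφD.isCent_apply h hn1 ?_ ?_ <;>
        simp only [LinearMap.sub_apply, hDe, mul_sub, sub_mul, mul_add, mul_assoc, hc.ee,
          hc.ff, hc.ee_mul, hc.ff_mul, hc.ef_mul, hc.fe_mul, add_zero,
          zero_add, sub_self]
    obtain ⟨d, δ, γ, hd, hδ, hδee, hδff, hδef, hδfe, hγ, hsum⟩ :=
      (hφD.adCompatible hcent).exists_decomposition h
        (fun x => by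
          simpa [mul_sub, sub_mul, hDd.mul_map_mul_eq_zero hc (hee x)] using hφe x)
        (fun x => by
          simpa [mul_sub, sub_mul, hDd.mul_map_mul_eq_zero hc.symm (hff x)] using hφf x)
    have hδmem : ∀ x, δ x ∈ offDiagonal R e f := by
      refine hc.induction (fun x y hx hy => ?_) (fun a ha => ?_) (fun m hm => ?_) (fun t ht => ?_)
        (fun b hb => ?_)
      · rw [map_add]
        exact add_mem hx hy
      · rw [hδee a ha]
        exact zero_mem _
      · rw [mem_offDiagonal, ← (hδef m hm).eq]
        simp [mul_assoc, hc.ef_mul, hc.ef]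
      · rw [mem_offDiagonal, ← (hδfe t ht).eq]
        simp [mul_assoc, hc.fe_mul, hc.fe]
      · rw [hδff b hb]
        exact zero_mem _
    rw [hsum] at hφD
    subst hf
    refine ⟨d + D, δ, γ, fun x y => ?_, ⟨hδ.isJordanDeriv, fun a => hδee _ (hee a),
      fun b => hδff _ (hff b), fun m => (hδef _ (hef m)).eq.symm,
      fun t => (hδfe _ (hfe t)).eq.symm⟩, hδ, hγ,
      vanishesOnNCommutators_of_add h hn hφD hd hδmem hγ, ?_⟩
    · simp only [LinearMap.add_apply, hd x y, hDd x y, add_mul, mul_add]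
      abel
    · rw [← sub_add_cancel φ D, hsum]
      abel
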